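/- arXiv:1703.00608 — 3 statements merged into one kernel-verified Lean document; each statement's English description precedes it below -/
import Mathlib

section
/- Let η_dis, η_ch ∈ (0,1] be the discharge and charge efficiencies of a storage device, and suppose its discharge level q_dis and charge level q_ch at some time are both strictly positive (simultaneous charging and discharging). Then there exist alternative levels q̄_dis ≥ 0 and q̄_ch ≥ 0 such that: (i) q̄_dis · q̄_ch = 0 (at most one of them is positive); (ii) q̄_dis ≤ q_dis and q̄_ch ≤ q_ch; (iii) the net electricity flow is preserved, i.e. η_dis·q̄_dis − q̄_ch/η_ch = η_dis·q_dis − q_ch/η_ch; and (iv) the total throughput strictly decreases, i.e. q̄_dis + q̄_ch < q_dis + q_ch. Consequently, for any unit operation cost c > 0, the operation cost strictly decreases: c·(q̄_dis + q̄_ch) < c·(q_dis + q_ch). -/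
/-- Proposition 1 (core): a strategy with simultaneously positive charge and
discharge levels is strictly cost-dominated by a strategy with the same net
electricity flow in which at most one of the two levels is positive. -/
theorem storage_no_simultaneous_charge_discharge
    (ηdis ηch qdis qch : ℝ)
    (hηdis : ηdis ∈ Set.Ioc (0 : ℝ) 1) (hηch : ηch ∈ Set.Ioc (0 : ℝ) 1)
    (hqdis : 0 < qdis) (hqch : 0 < qch) :
    ∃ qdis' qch' : ℝ,
      0 ≤ qdis' ∧ 0 ≤ qch' ∧
      qdis' * qch' = 0 ∧
      qdis' ≤ qdis ∧ qch' ≤ qch ∧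
      ηdis * qdis' - qch' / ηch = ηdis * qdis - qch / ηch ∧
      qdis' + qch' < qdis + qch ∧
      ∀ c : ℝ, 0 < c → c * (qdis' + qch') < c * (qdis + qch) := by
  obtain ⟨hd, -⟩ := hηdis
  obtain ⟨hc, -⟩ := hηch
  have hp : 0 < ηdis * ηch := mul_pos hd hc
  rcases le_total qch (ηdis * ηch * qdis) with h | h
  · have hpos : 0 < qch / (ηdis * ηch) := div_pos hqch hp
    have hle : qch / (ηdis * ηch) ≤ qdis := (div_le_iff₀' hp).2 h
    have hlt : qdis - qch / (ηdis * ηch) + 0 < qdis + qch := by linarith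
    refine ⟨qdis - qch / (ηdis * ηch), 0, by linarith, le_rfl, mul_zero _, by linarith,
      hqch.le, ?_, hlt, fun c hc' => mul_lt_mul_of_pos_left hlt hc'⟩
    field_simp
    ring
  · have hpos : 0 < ηdis * ηch * qdis := mul_pos hp hqdis
    have hlt : 0 + (qch - ηdis * ηch * qdis) < qdis + qch := by linarith
    refine ⟨0, qch - ηdis * ηch * qdis, le_rfl, by linarith, zero_mul _, hqdis.le,
      by linarith, ?_, hlt, fun c hc' => mul_lt_mul_of_pos_left hlt hc'⟩
    field_simp
    ring
end

section
/- Let α > 0, β > 0, c ≥ 0 and s ∈ ℝ, and define the profit function g : ℝ → ℝ by g(x) = (α·exp(−β·(x+s)) − c)·x. Then g is quasiconcave on ℝ, i.e. for every t ∈ ℝ the superlevel set {x ∈ ℝ : g(x) ≥ t} is convex. -/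
theorem quasiconcaveOn_univ_of_concaveOn_Iic_of_antitoneOn_Ici {f : ℝ → ℝ} {a b : ℝ} (hab : a ≤ b)
    (hconc : ConcaveOn ℝ (Set.Iic b) f) (hanti : AntitoneOn f (Set.Ici a)) :
    QuasiconcaveOn ℝ Set.univ f := by
  intro t
  refine Set.OrdConnected.convex ⟨?_⟩
  rintro x ⟨-, hx⟩ z ⟨-, hz⟩ y ⟨hxy, hyz⟩
  refine ⟨trivial, ?_⟩
  rcases le_total a y with hay | hya
  · exact hz.trans (hanti hay (hay.trans hyz) hyz)
  · have hmin : t ≤ f (min z b) := by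
      rcases le_total z b with h | h
      · rwa [min_eq_left h]
      · rw [min_eq_right h]
        exact hz.trans (hanti hab (hab.trans h) h)
    exact ((hconc.quasiconcaveOn t).ordConnected.out ⟨hxy.trans (hya.trans hab), hx⟩
      ⟨min_le_right z b, hmin⟩ ⟨hxy, le_min hyz (hya.trans hab)⟩).2

theorem hasDerivAt_exp_neg_mul_add (β s x : ℝ) :
    HasDerivAt (fun x => Real.exp (-β * (x + s))) (Real.exp (-β * (x + s)) * -β) x := by
  simpa using (((hasDerivAt_id x).add_const s).const_mul (-β)).exp

theorem hasDerivAt_profit (α β c s x : ℝ) :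
    HasDerivAt (fun x => (α * Real.exp (-β * (x + s)) - c) * x)
      (α * Real.exp (-β * (x + s)) * (1 - β * x) - c) x := by
  refine ((((hasDerivAt_exp_neg_mul_add β s x).const_mul α).sub_const c).mul
    (hasDerivAt_id' x)).congr_deriv ?_
  ring

theorem hasDerivAt_marginal_profit (α β c s x : ℝ) :
    HasDerivAt (fun x => α * Real.exp (-β * (x + s)) * (1 - β * x) - c)
      (α * Real.exp (-β * (x + s)) * (β * (β * x - 2))) x := by
  refine ((((hasDerivAt_exp_neg_mul_add β s x).const_mul α).mul
    (((hasDerivAt_id' x).const_mul β).const_sub 1)).sub_const c).congr_deriv ?_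
  ring

theorem concaveOn_profit {α β : ℝ} (c s : ℝ) (hα : 0 ≤ α) (hβ : 0 < β) :
    ConcaveOn ℝ (Set.Iic (2 / β)) fun x => (α * Real.exp (-β * (x + s)) - c) * x := by
  refine concaveOn_of_hasDerivWithinAt2_nonpos (convex_Iic _)
    (fun x _ => (hasDerivAt_profit α β c s x).continuousAt.continuousWithinAt)
    (fun x _ => (hasDerivAt_profit α β c s x).hasDerivWithinAt)
    (fun x _ => (hasDerivAt_marginal_profit α β c s x).hasDerivWithinAt) fun x hx => ?_
  have hx' : x * β ≤ 2 := (le_div_iff₀ hβ).1 (Set.mem_Iic.1 (interior_subset hx))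
  exact mul_nonpos_of_nonneg_of_nonpos (by positivity)
    (mul_nonpos_of_nonneg_of_nonpos hβ.le (by linarith))

theorem antitoneOn_profit {α β c : ℝ} (s : ℝ) (hα : 0 ≤ α) (hβ : 0 < β) (hc : 0 ≤ c) :
    AntitoneOn (fun x => (α * Real.exp (-β * (x + s)) - c) * x) (Set.Ici (1 / β)) := by
  refine antitoneOn_of_hasDerivWithinAt_nonpos (convex_Ici _)
    (fun x _ => (hasDerivAt_profit α β c s x).continuousAt.continuousWithinAt)
    (fun x _ => (hasDerivAt_profit α β c s x).hasDerivWithinAt) fun x hx => ?_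
  have hx' : 1 ≤ x * β := (div_le_iff₀ hβ).1 (Set.mem_Ici.1 (interior_subset hx))
  have : α * Real.exp (-β * (x + s)) * (1 - β * x) ≤ 0 :=
    mul_nonpos_of_nonneg_of_nonpos (by positivity) (by linarith)
  linarith

/-- Quasi-concavity of the profit function x ↦ (α·exp(−β·(x+s)) − c)·x:
every superlevel set is convex. -/
theorem profit_quasiconcave
    (α β c s : ℝ) (hα : 0 < α) (hβ : 0 < β) (hc : 0 ≤ c) :
    ∀ t : ℝ,
      Convex ℝ {x : ℝ | t ≤ (α * Real.exp (-β * (x + s)) - c) * x} := by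
  have hab : 1 / β ≤ 2 / β := by gcongr; norm_num
  intro t
  simpa using quasiconcaveOn_univ_of_concaveOn_Iic_of_antitoneOn_Ici hab
    (concaveOn_profit c s hα.le hβ) (antitoneOn_profit s hα.le hβ hc) t
end

section
/- Let α > 0, β > 0, c > 0 and s ∈ ℝ, and define h : ℝ → ℝ by h(x) = α·exp(−β·(x+s))·(1 − β·x) − c (the derivative of the profit function x ↦ (α·exp(−β·(x+s)) − c)·x). Then there exists x₀ < 1/β such that h(x) > 0 for all x < x₀ and h(x) < 0 for all x > x₀. -/
/-- The marginal revenue at a point below `1 / β` exceeds the one at any larger point. -/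
lemma marginal_revenue_lt {α β s x y : ℝ} (hα : 0 < α) (hβ : 0 < β) (hx : x < 1 / β)
    (hxy : x < y) :
    α * Real.exp (-β * (y + s)) * (1 - β * y) < α * Real.exp (-β * (x + s)) * (1 - β * x) := by
  have hβxy : β * x < β * y := mul_lt_mul_of_pos_left hxy hβ
  have hpos : 0 < 1 - β * x := by
    rw [lt_div_iff₀ hβ] at hx
    linarith
  have hexp : Real.exp (-β * (y + s)) < Real.exp (-β * (x + s)) :=
    Real.exp_lt_exp.2 (by linarith)
  calc α * Real.exp (-β * (y + s)) * (1 - β * y)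
      < α * Real.exp (-β * (y + s)) * (1 - β * x) :=
        mul_lt_mul_of_pos_left (by linarith) (by positivity)
    _ < α * Real.exp (-β * (x + s)) * (1 - β * x) :=
        mul_lt_mul_of_pos_right (mul_lt_mul_of_pos_left hexp hα) hpos

/-- Marginal revenue takes every positive value at some point below `1 / β`. -/
lemma exists_marginal_revenue_eq {α β c : ℝ} (s : ℝ) (hα : 0 < α) (hβ : 0 < β) (hc : 0 < c) :
    ∃ x < 1 / β, α * Real.exp (-β * (x + s)) * (1 - β * x) = c := by
  set a : ℝ := -|s| - c / (α * β) with ha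
  have hq : 0 < c / (α * β) := by positivity
  have hab : a ≤ 1 / β := by
    have : 0 < 1 / β := by positivity
    linarith [abs_nonneg s]
  have hleft : c ≤ α * Real.exp (-β * (a + s)) * (1 - β * a) := by
    have hexp : 1 ≤ Real.exp (-β * (a + s)) :=
      Real.one_le_exp (by nlinarith [le_abs_self s])
    have hlin : c ≤ α * (1 - β * a) := by
      have : α * (1 - β * a) = α + α * β * |s| + c := by
        rw [ha]
        field_simp
        ring
      have : 0 ≤ α * β * |s| := by positivity
      linarith
    nlinarith
  have hright : α * Real.exp (-β * (1 / β + s)) * (1 - β * (1 / β)) = 0 := by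
    rw [mul_one_div_cancel hβ.ne', sub_self, mul_zero]
  obtain ⟨x, hx, hxc⟩ := intermediate_value_Icc' hab
    (f := fun x => α * Real.exp (-β * (x + s)) * (1 - β * x))
    (by fun_prop) ⟨hright.le.trans hc.le, hleft⟩
  refine ⟨x, lt_of_le_of_ne hx.2 ?_, hxc⟩
  rintro rfl
  exact hc.ne (hright.symm.trans hxc)

/-- Single sign change of the profit derivative
h(x) = α·exp(−β·(x+s))·(1 − β·x) − c: there is a threshold x₀ < 1/β with
h positive below x₀ and negative above x₀. -/
theorem profit_derivative_single_sign_change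
    (α β c s : ℝ) (hα : 0 < α) (hβ : 0 < β) (hc : 0 < c) :
    ∃ x₀ : ℝ, x₀ < 1 / β ∧
      (∀ x : ℝ, x < x₀ → 0 < α * Real.exp (-β * (x + s)) * (1 - β * x) - c) ∧
      (∀ x : ℝ, x₀ < x → α * Real.exp (-β * (x + s)) * (1 - β * x) - c < 0) := by
  obtain ⟨x₀, hx₀, hc₀⟩ := exists_marginal_revenue_eq s hα hβ hc
  refine ⟨x₀, hx₀, fun x hx => ?_, fun x hx => ?_⟩
  · rw [← hc₀]
    exact sub_pos.2 (marginal_revenue_lt hα hβ (hx.trans hx₀) hx)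
  · rw [← hc₀]
    exact sub_neg.2 (marginal_revenue_lt hα hβ hx₀ hx)
end
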